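/- Let Γ be a cubic simple graph of girth 6 whose automorphism group acts transitively on the set of its 3-arcs, and suppose Γ contains no consistent cycle of length 6. Then for every 6-cycle v_0 v_1 v_2 v_3 v_4 v_5 v_0 in Γ and every pair of antipodal vertices v_i, v_{i+3} on it, there is a path of length 3 in Γ from v_i to v_{i+3} that shares no edge with the 6-cycle. -/

import Mathlib

open SimpleGraph

/-- `x 0, x 1, …, x s` is an `s`-arc of `G`: consecutive vertices are adjacent and
`x i ≠ x (i+2)` whenever both are defined. -/
def IsNArc {V : Type*} (G : SimpleGraph V) (s : ℕ) (x : ℕ → V) : Prop :=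
  (∀ i < s, G.Adj (x i) (x (i + 1))) ∧ ∀ i, i + 2 ≤ s → x i ≠ x (i + 2)

/-- The automorphism group of `G` acts transitively on the `s`-arcs of `G`. -/
def IsNArcTransitive {V : Type*} (G : SimpleGraph V) (s : ℕ) : Prop :=
  ∀ x y : ℕ → V, IsNArc G s x → IsNArc G s y → ∃ φ : G ≃g G, ∀ i ≤ s, φ (x i) = y i
/-- `G` contains a consistent cycle of length `n`: a cycle `c 0, c 1, …, c (n-1), c 0`
together with an automorphism rotating it by one step. -/
def HasConsistentCycle {V : Type*} (G : SimpleGraph V) (n : ℕ) : Prop :=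
  ∃ c : ZMod n → V, Function.Injective c ∧ (∀ i, G.Adj (c i) (c (i + 1))) ∧
    ∃ γ : G ≃g G, ∀ i, γ (c i) = c (i + 1)

theorem aux_no_three {V : Type*} (G : SimpleGraph V) (hg : G.egirth = 6) {a b c : V}
    (h1 : G.Adj a b) (h2 : G.Adj b c) (h3 : G.Adj c a) : False := by
  have hc : (Walk.cons h1 (Walk.cons h2 (Walk.cons h3 Walk.nil))).IsCycle := by
    have := h1.ne
    have := h2.ne
    have := h3.ne
    rw [Walk.cons_isCycle_iff]
    simp [Walk.isPath_def]
    grind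
  have h := le_egirth.mp hg.ge _ _ hc
  simp only [Walk.length_cons, Walk.length_nil] at h
  exact absurd h (by decide)

theorem aux_no_four {V : Type*} (G : SimpleGraph V) (hg : G.egirth = 6) {a b c d : V}
    (h1 : G.Adj a b) (h2 : G.Adj b c) (h3 : G.Adj c d) (h4 : G.Adj d a)
    (hac : a ≠ c) : b = d := by
  by_contra hbd
  have hc : (Walk.cons h1 (Walk.cons h2 (Walk.cons h3 (Walk.cons h4 Walk.nil)))).IsCycle := by
    have := h1.ne
    have := h2.ne
    have := h3.ne
    have := h4.ne
    rw [Walk.cons_isCycle_iff]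
    simp [Walk.isPath_def]
    grind
  have h := le_egirth.mp hg.ge _ _ hc
  simp only [Walk.length_cons, Walk.length_nil] at h
  exact absurd h (by decide)

/-- If the hexagon has no third path from `c 0` to `c 3`, it is consistent. -/
theorem aux_main {V : Type*} (G : SimpleGraph V) (hg : G.egirth = 6)
    (ht : IsNArcTransitive G 3) (hn : ¬ HasConsistentCycle G 6)
    (c : ZMod 6 → V) (hi : Function.Injective c) (ha : ∀ i, G.Adj (c i) (c (i + 1))) :
    ∃ p q : V, G.Adj (c 0) p ∧ G.Adj p q ∧ G.Adj q (c 3) ∧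
      p ≠ c 1 ∧ p ≠ c 5 ∧ q ≠ c 2 ∧ q ≠ c 4 := by
  by_contra hno
  have a0 : G.Adj (c 0) (c 1) := ha 0
  have a1 : G.Adj (c 1) (c 2) := ha 1
  have a2 : G.Adj (c 2) (c 3) := ha 2
  have a3 : G.Adj (c 3) (c 4) := ha 3
  have a4 : G.Adj (c 4) (c 5) := ha 4
  have a5 : G.Adj (c 5) (c 0) := ha 5
  have ne : ∀ i j : ZMod 6, i ≠ j → c i ≠ c j := fun i j h e => h (hi e)
  have uniq : ∀ p q : V, G.Adj (c 0) p → G.Adj p q → G.Adj q (c 3) → p ≠ c 1 →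
      p = c 5 ∧ q = c 4 := by
    intro p q h1 h2 h3 hp
    have hq : q ≠ c 2 := by
      rintro rfl
      exact hp (aux_no_four G hg h1 h2 a1.symm a0.symm (ne 0 2 (by decide)))
    by_cases hp5 : p = c 5
    · subst hp5
      exact ⟨rfl, aux_no_four G hg h2 h3 a3 a4 (ne 5 3 (by decide))⟩
    · exfalso
      refine hno ⟨p, q, h1, h2, h3, hp, hp5, hq, ?_⟩
      rintro rfl
      exact hp5 (aux_no_four G hg h1 h2 a4 a5 (ne 0 4 (by decide)))
  obtain ⟨φ, hφ⟩ := ht (fun n => c n) (fun n => c (n + 1))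
    ⟨fun i _ => by simpa using ha i, fun i hi2 => by
      refine ne _ _ ?_
      push_cast
      intro h
      exact absurd (left_eq_add.mp h) (by decide)⟩
    ⟨fun i _ => by simpa using ha (i + 1), fun i hi2 => by
      refine ne _ _ ?_
      push_cast
      intro h
      exact absurd (left_eq_add.mp (add_right_cancel h)) (by decide)⟩
  have f0 : φ (c 0) = c 1 := hφ 0 (by norm_num)
  have f1 : φ (c 1) = c 2 := hφ 1 (by norm_num)
  have f2 : φ (c 2) = c 3 := hφ 2 (by norm_num)
  have f3 : φ (c 3) = c 4 := hφ 3 (by norm_num)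
  have key := uniq (φ.symm (c 0)) (φ.symm (c 5))
    (by rw [← φ.map_adj_iff, f0]; simpa using a0.symm)
    (by rw [φ.symm.map_adj_iff]; exact a5.symm)
    (by rw [← φ.map_adj_iff, f3]; simpa using a4.symm)
    (by
      intro h
      have h' := congrArg φ h
      rw [f1] at h'
      exact ne 0 2 (by decide) (by simpa using h'))
  have f5 : φ (c 5) = c 0 := by rw [← key.1]; simp
  have f4 : φ (c 4) = c 5 := by rw [← key.2]; simp
  refine hn ⟨c, hi, ha, φ, ?_⟩
  intro i
  have hcase : ∀ i : ZMod 6, i = 0 ∨ i = 1 ∨ i = 2 ∨ i = 3 ∨ i = 4 ∨ i = 5 := by decide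
  rcases hcase i with rfl | rfl | rfl | rfl | rfl | rfl
  exacts [f0, f1, f2, f3, f4, f5]

/-- In a cubic 3-arc-transitive graph of girth 6 with no consistent 6-cycle, any two
antipodal vertices of any 6-cycle are joined by a path of length 3 sharing no edge
with the 6-cycle. -/
theorem antipodal_path_of_no_consistent_cycle
    {V : Type*} (Γ : SimpleGraph V)
    (hcubic : ∀ v : V, (Γ.neighborSet v).ncard = 3)
    (hgirth : Γ.egirth = 6)
    (htrans : IsNArcTransitive Γ 3)
    (hnocons : ¬ HasConsistentCycle Γ 6) :
    ∀ c : ZMod 6 → V, Function.Injective c → (∀ i, Γ.Adj (c i) (c (i + 1))) →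
      ∀ i : ZMod 6, ∃ p₀ p₁ p₂ p₃ : V, p₀ = c i ∧ p₃ = c (i + 3) ∧
        Γ.Adj p₀ p₁ ∧ Γ.Adj p₁ p₂ ∧ Γ.Adj p₂ p₃ ∧
        p₀ ≠ p₁ ∧ p₀ ≠ p₂ ∧ p₀ ≠ p₃ ∧ p₁ ≠ p₂ ∧ p₁ ≠ p₃ ∧ p₂ ≠ p₃ ∧
        ∀ j : ZMod 6, s(p₀, p₁) ≠ s(c j, c (j + 1)) ∧ s(p₁, p₂) ≠ s(c j, c (j + 1)) ∧
          s(p₂, p₃) ≠ s(c j, c (j + 1)) := by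
  intro c hi ha i
  have hd : ∀ j, Γ.Adj (c (i + j)) (c (i + (j + 1))) := fun j => by
    rw [← add_assoc]; exact ha _
  obtain ⟨p, q, h1, h2, h3, hp1, hp5, hq2, hq4⟩ := aux_main Γ hgirth htrans hnocons
    (fun j => c (i + j)) (fun a b h => add_left_cancel (hi h)) hd
  have ne : ∀ a b : ZMod 6, a ≠ b → c (i + a) ≠ c (i + b) :=
    fun a b h e => h (add_left_cancel (hi e))
  have a0 : Γ.Adj (c (i + 0)) (c (i + 1)) := hd 0
  have a1 : Γ.Adj (c (i + 1)) (c (i + 2)) := hd 1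
  have a2 : Γ.Adj (c (i + 2)) (c (i + 3)) := hd 2
  have a3 : Γ.Adj (c (i + 3)) (c (i + 4)) := hd 3
  have a4 : Γ.Adj (c (i + 4)) (c (i + 5)) := hd 4
  have a5 : Γ.Adj (c (i + 5)) (c (i + 0)) := hd 5
  have hcase : ∀ i : ZMod 6, i = 0 ∨ i = 1 ∨ i = 2 ∨ i = 3 ∨ i = 4 ∨ i = 5 := by decide
  have n03 : ¬ Γ.Adj (c (i + 0)) (c (i + 3)) := fun h =>
    ne 1 3 (by decide) (aux_no_four Γ hgirth a0 a1 a2 h.symm (ne 0 2 (by decide)))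
  have hpc : ∀ j, p ≠ c (i + j) := by
    intro j hj
    subst hj
    rcases hcase j with rfl | rfl | rfl | rfl | rfl | rfl
    · exact h1.ne rfl
    · exact hp1 rfl
    · exact aux_no_three Γ hgirth a0 a1 h1.symm
    · exact n03 h1
    · exact aux_no_three Γ hgirth a4 a5 h1
    · exact hp5 rfl
  have hqc : ∀ j, q ≠ c (i + j) := by
    intro j hj
    subst hj
    rcases hcase j with rfl | rfl | rfl | rfl | rfl | rfl
    · exact n03 h3
    · exact aux_no_three Γ hgirth a1 a2 h3.symm
    · exact hq2 rfl
    · exact h3.ne rfl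
    · exact hq4 rfl
    · exact aux_no_three Γ hgirth a3 a4 h3
  have hpc' : ∀ j, p ≠ c j := fun j => by simpa using hpc (j - i)
  have hqc' : ∀ j, q ≠ c j := fun j => by simpa using hqc (j - i)
  have h1' : Γ.Adj (c i) p := by simpa using h1
  refine ⟨c i, p, q, c (i + 3), rfl, rfl, h1', h2, h3, h1'.ne, (hqc' _).symm, ?_, h2.ne,
    hpc' _, h3.ne, ?_⟩
  · simpa using ne 0 3 (by decide)
  · intro j
    have u1 := hpc' j
    have u2 := hpc' (j + 1)
    have u3 := hqc' j
    have u4 := hqc' (j + 1)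
    refine ⟨?_, ?_, ?_⟩ <;> rw [Ne, Sym2.eq_iff] <;> tauto
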